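/- The braid group B_n is torsion-free: if g ∈ B_n satisfies g^k = 1 for some integer k ≥ 1, then g = 1. -/

import Mathlib

/-- The braid relators in the free group over `Fin (n - 1)`: the index `i` stands for the
Artin generator `σ_{i+1}` (indices are 0-based), and the relators express
`σ_i σ_j σ_i = σ_j σ_i σ_j` for `|i - j| = 1` and `σ_i σ_j = σ_j σ_i` for `|i - j| ≥ 2`. -/
def braidRelsGroup (n : ℕ) : Set (FreeGroup (Fin (n - 1))) :=
  { r | (∃ i j : Fin (n - 1), (i : ℕ) + 1 = (j : ℕ) ∧
          r = .of i * .of j * .of i * (.of j * .of i * .of j)⁻¹) ∨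
        (∃ i j : Fin (n - 1), (i : ℕ) + 2 ≤ (j : ℕ) ∧
          r = .of i * .of j * (.of j * .of i)⁻¹) }

/-- The braid group `B_n`, presented by the generators `σ_1, …, σ_{n-1}` and the
braid relations. -/
def BraidGroup (n : ℕ) := PresentedGroup (braidRelsGroup n)

instance (n : ℕ) : Group (BraidGroup n) :=
  inferInstanceAs (Group (PresentedGroup (braidRelsGroup n)))

/-- The generator `σ_{i+1}` of the braid group `B_n` (0-based index `i : Fin (n - 1)`). -/
def σG {n : ℕ} (i : Fin (n - 1)) : BraidGroup n := PresentedGroup.of i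

/-- Indices of generators satisfying the braid relation of length three. -/
def BraidAdj {m : ℕ} (i j : Fin m) : Prop := (i : ℕ) + 1 = j ∨ (j : ℕ) + 1 = i

instance {m : ℕ} (i j : Fin m) : Decidable (BraidAdj i j) :=
  inferInstanceAs (Decidable (_ ∨ _))

theorem BraidAdj.symm {m : ℕ} {i j : Fin m} (h : BraidAdj i j) : BraidAdj j i := Or.symm h

theorem BraidAdj.ne {m : ℕ} {i j : Fin m} (h : BraidAdj i j) : i ≠ j := by
  rintro rfl
  unfold BraidAdj at h
  omega

/-- The positive braid relations on `m` generators. -/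
inductive BraidMonoidRel (m : ℕ) : FreeMonoid (Fin m) → FreeMonoid (Fin m) → Prop
  | braid (i j : Fin m) (h : BraidAdj i j) : BraidMonoidRel m (.of i * .of j * .of i)
      (.of j * .of i * .of j)
  | comm (i j : Fin m) (hij : i ≠ j) (h : ¬ BraidAdj i j) :
      BraidMonoidRel m (.of i * .of j) (.of j * .of i)

/-- The monoid of positive braids with `m` generators. -/
abbrev BraidMonoid (m : ℕ) := PresentedMonoid (BraidMonoidRel m)

namespace BraidMonoid

variable {m : ℕ}

/-- A generator of the braid monoid. -/
def gen (i : Fin m) : BraidMonoid m := PresentedMonoid.of _ i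

theorem gen_braid {i j : Fin m} (h : BraidAdj i j) :
    gen i * gen j * gen i = gen j * gen i * gen j :=
  PresentedMonoid.mk_eq_mk_of_rel (.braid i j h)

theorem gen_comm {i j : Fin m} (h : ¬ BraidAdj i j) : gen i * gen j = gen j * gen i := by
  by_cases hij : i = j
  · rw [hij]
  · exact PresentedMonoid.mk_eq_mk_of_rel (.comm i j hij h)

theorem gen_braid_mul {i j : Fin m} (h : BraidAdj i j) (z : BraidMonoid m) :
    gen i * (gen j * (gen i * z)) = gen j * (gen i * (gen j * z)) := by
  simp only [← mul_assoc, gen_braid h]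

theorem gen_comm_mul {i j : Fin m} (h : ¬ BraidAdj i j) (z : BraidMonoid m) :
    gen i * (gen j * z) = gen j * (gen i * z) := by
  simp only [← mul_assoc, gen_comm h]

@[elab_as_elim]
theorem induction_gen {P : BraidMonoid m → Prop} (x : BraidMonoid m) (one : P 1)
    (mul : ∀ i x, P x → P (gen i * x)) : P x := by
  obtain ⟨w, rfl⟩ := PresentedMonoid.surjective_mk x
  induction w using FreeMonoid.inductionOn' with
  | one => simpa using one
  | of_mul i w ih => rw [map_mul]; exact mul i _ ih

/-- The length of positive braids, as a homomorphism. -/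
def lenHom (m : ℕ) : BraidMonoid m →* Multiplicative ℕ :=
  PresentedMonoid.lift (fun _ => Multiplicative.ofAdd 1) (by rintro _ _ (_ | _) <;> simp)

/-- The length of a positive braid. -/
def len (x : BraidMonoid m) : ℕ := (lenHom m x).toAdd

@[simp] theorem len_one : len (1 : BraidMonoid m) = 0 := by simp [len]

@[simp] theorem len_mul (x y : BraidMonoid m) : len (x * y) = len x + len y := by simp [len]

@[simp] theorem len_gen (i : Fin m) : len (gen i) = 1 := rfl

@[simp] theorem len_pow (x : BraidMonoid m) (k : ℕ) : len (x ^ k) = k * len x := by simp [len]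

theorem eq_one_of_len {x : BraidMonoid m} (h : len x = 0) : x = 1 := by
  induction x using induction_gen with
  | one => rfl
  | mul i x _ => simp at h

/-- The right complement of `i` in the least common right multiple of the generators `i`, `j`. -/
def compl (i j : Fin m) : BraidMonoid m :=
  if i = j then 1 else if BraidAdj i j then gen j * gen i else gen j

theorem compl_self (i : Fin m) : compl i i = 1 := if_pos rfl

theorem compl_adj {i j : Fin m} (h : BraidAdj i j) : compl i j = gen j * gen i := by
  rw [compl, if_neg h.ne, if_pos h]

theorem compl_far {i j : Fin m} (hij : i ≠ j) (h : ¬ BraidAdj i j) : compl i j = gen j := by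
  rw [compl, if_neg hij, if_neg h]

theorem gen_mul_compl (i j : Fin m) : gen i * compl i j = gen j * compl j i := by
  by_cases hij : i = j
  · rw [hij]
  by_cases h : BraidAdj i j
  · rw [compl_adj h, compl_adj h.symm, ← mul_assoc, gen_braid h, mul_assoc]
  · rw [compl_far hij h, compl_far (Ne.symm hij) (mt BraidAdj.symm h), gen_comm h]

/-- `gen i * x` and `gen j * y` are the same right multiple of the least common
right multiple of `gen i` and `gen j`. -/
def Compat (i j : Fin m) (x y : BraidMonoid m) : Prop :=
  ∃ z, x = compl i j * z ∧ y = compl j i * z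

theorem Compat.symm {i j : Fin m} {x y : BraidMonoid m} (h : Compat i j x y) :
    Compat j i y x := by
  obtain ⟨z, h₁, h₂⟩ := h
  exact ⟨z, h₂, h₁⟩

theorem compat_self {i : Fin m} {x y : BraidMonoid m} : Compat i i x y ↔ x = y := by
  simp [Compat, compl_self, eq_comm]

theorem compat_adj {i j : Fin m} (h : BraidAdj i j) {x y : BraidMonoid m} :
    Compat i j x y ↔ ∃ z, x = gen j * (gen i * z) ∧ y = gen i * (gen j * z) := by
  simp [Compat, compl_adj h, compl_adj h.symm, mul_assoc]

theorem compat_far {i j : Fin m} (hij : i ≠ j) (h : ¬ BraidAdj i j) {x y : BraidMonoid m} :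
    Compat i j x y ↔ ∃ z, x = gen j * z ∧ y = gen i * z := by
  simp [Compat, compl_far hij h, compl_far hij.symm (mt BraidAdj.symm h)]

/-- Equal products starting with generators are compatible, up to a length bound. -/
def CompatBelow (m N : ℕ) : Prop :=
  ∀ (i j : Fin m) (x y : BraidMonoid m), len x < N → gen i * x = gen j * y → Compat i j x y

theorem CompatBelow.cancel {N : ℕ} (H : CompatBelow m N) {i : Fin m} {x y : BraidMonoid m}
    (hx : len x < N) (h : gen i * x = gen i * y) : x = y :=
  compat_self.1 (H i i x y hx h)

theorem CompatBelow.adj {N : ℕ} (H : CompatBelow m N) {i j : Fin m} (hij : BraidAdj i j)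
    {x y : BraidMonoid m} (hx : len x < N) (h : gen i * x = gen j * y) :
    ∃ z, x = gen j * (gen i * z) ∧ y = gen i * (gen j * z) :=
  (compat_adj hij).1 (H i j x y hx h)

theorem CompatBelow.far {N : ℕ} (H : CompatBelow m N) {i j : Fin m} (hne : i ≠ j)
    (hij : ¬ BraidAdj i j) {x y : BraidMonoid m} (hx : len x < N) (h : gen i * x = gen j * y) :
    ∃ z, x = gen j * z ∧ y = gen i * z :=
  (compat_far hne hij).1 (H i j x y hx h)

theorem CompatBelow.trans_far_adj {N : ℕ} (H : CompatBelow m N) {a b c : Fin m}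
    (hac : a ≠ c) (hab : a ≠ b) (fac : ¬ BraidAdj a c) (acb : BraidAdj c b)
    {x w y : BraidMonoid m} (hx : len x ≤ N) (h₁ : Compat a c x w) (h₂ : Compat c b w y) :
    Compat a b x y := by
  obtain ⟨p, rfl, hw⟩ := (compat_far hac fac).1 h₁
  obtain ⟨q, rfl, rfl⟩ := (compat_adj acb).1 h₂
  have hl := congrArg len hw
  simp only [len_mul, len_gen] at hx hl
  by_cases adj : BraidAdj a b
  · obtain ⟨r, rfl, hr⟩ := H.adj adj (by omega) hw.symm
    simp only [len_mul, len_gen] at hx hl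
    obtain ⟨t, rfl, ht⟩ := H.far hac.symm (mt BraidAdj.symm fac) (by omega) hr
    simp only [len_mul, len_gen] at hx hl
    obtain ⟨s, rfl, rfl⟩ := H.adj acb.symm (by omega) ht
    refine (compat_adj adj).2 ⟨gen c * (gen b * (gen a * s)), ?_, ?_⟩
    · rw [gen_comm_mul fac (gen b * s), gen_braid_mul acb, gen_braid_mul adj.symm,
        gen_comm_mul fac]
    · rw [gen_braid_mul adj.symm, gen_comm_mul (mt BraidAdj.symm fac),
        gen_comm_mul fac s, gen_braid_mul acb]
  · obtain ⟨r, rfl, hr⟩ := H.far hab adj (by omega) hw.symm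
    simp only [len_mul, len_gen] at hx hl
    obtain ⟨t, rfl, rfl⟩ := H.far hac.symm (mt BraidAdj.symm fac) (by omega) hr
    refine (compat_far hab adj).2 ⟨gen c * (gen b * t), gen_braid_mul acb t, ?_⟩
    rw [gen_comm_mul (mt BraidAdj.symm adj), gen_comm_mul (mt BraidAdj.symm fac)]

theorem Compat.len_eq {i j : Fin m} {x y : BraidMonoid m} (h : Compat i j x y) :
    len x = len y := by
  obtain ⟨z, rfl, rfl⟩ := h
  have := congrArg len (gen_mul_compl i j)
  simp only [len_mul, len_gen] at this ⊢
  omega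

theorem CompatBelow.trans {N : ℕ} (H : CompatBelow m N) {a b c : Fin m}
    {x w y : BraidMonoid m} (hx : len x ≤ N) (h₁ : Compat a c x w) (h₂ : Compat c b w y) :
    Compat a b x y := by
  by_cases hac : a = c
  · subst hac
    rwa [compat_self.1 h₁]
  by_cases hcb : c = b
  · subst hcb
    rwa [← compat_self.1 h₂]
  by_cases hab : a = b
  · subst hab
    obtain ⟨p, rfl, rfl⟩ := h₁
    obtain ⟨q, hq, rfl⟩ := h₂
    refine compat_self.2 (congrArg _ ?_)
    by_cases h : BraidAdj a c
    · rw [compl_adj h.symm, mul_assoc, mul_assoc] at hq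
      rw [compl_adj h] at hx
      simp only [len_mul, len_gen] at hx
      exact H.cancel (by omega) (H.cancel (by simp; omega) hq)
    · rw [compl_far hcb (mt BraidAdj.symm h)] at hq
      rw [compl_far hac h] at hx
      simp only [len_mul, len_gen] at hx
      exact H.cancel (by omega) hq
  have hy : len y ≤ N := by rw [← h₂.len_eq, ← h₁.len_eq]; exact hx
  by_cases ac : BraidAdj a c <;> by_cases cb : BraidAdj c b
  · have ab : ¬ BraidAdj a b := by
      unfold BraidAdj at *
      omega
    obtain ⟨p, rfl, hw⟩ := (compat_adj ac).1 h₁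
    obtain ⟨q, rfl, rfl⟩ := (compat_adj cb).1 h₂
    have hl := congrArg len hw
    simp only [len_mul, len_gen] at hx hl
    obtain ⟨u, hp, hq⟩ := H.far (x := gen c * p) (y := gen c * q) hab ab (by simp; omega) hw.symm
    obtain ⟨v, rfl, rfl⟩ := H.adj cb (by omega) hp
    simp only [len_mul, len_gen] at hx hl
    obtain ⟨v', rfl, hv⟩ := H.adj ac.symm (by omega) hq
    simp only [len_mul, len_gen] at hx hl
    have hv := H.cancel (by simp; omega) hv
    obtain ⟨t, rfl, rfl⟩ := H.far (Ne.symm hab) (mt BraidAdj.symm ab) (by omega) hv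
    refine (compat_far hab ab).2 ⟨gen c * (gen a * (gen b * (gen c * t))), ?_, ?_⟩
    · rw [gen_comm_mul ab, gen_braid_mul ac, gen_braid_mul cb, gen_comm_mul ab]
    · rw [← gen_comm_mul ab, ← gen_braid_mul cb, gen_braid_mul ac.symm]
  · exact (H.trans_far_adj (Ne.symm hcb) (Ne.symm hab) (mt BraidAdj.symm cb) ac.symm hy
      h₂.symm h₁.symm).symm
  · exact H.trans_far_adj hac hab ac cb hx h₁ h₂
  · obtain ⟨p, rfl, hw⟩ := (compat_far hac ac).1 h₁
    obtain ⟨q, rfl, rfl⟩ := (compat_far hcb cb).1 h₂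
    simp only [len_mul, len_gen] at hx
    obtain ⟨r, rfl, rfl⟩ := H b a _ _ (by have := congrArg len hw; simp at this; omega) hw
    have key : ∀ {i j : Fin m} (z : BraidMonoid m), i ≠ j → ¬ BraidAdj i c → ¬ BraidAdj j c →
        gen c * (compl i j * z) = compl i j * (gen c * z) := by
      intro i j z hij hi hj
      by_cases h : BraidAdj i j
      · rw [compl_adj h, mul_assoc, mul_assoc, gen_comm_mul hi, gen_comm_mul hj]
      · rw [compl_far hij h, gen_comm_mul hj]
    have bc := mt BraidAdj.symm cb
    exact ⟨gen c * r, key _ hab ac bc, key _ (Ne.symm hab) bc ac⟩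

theorem mk_of (i : Fin m) : PresentedMonoid.mk (BraidMonoidRel m) (.of i) = gen i := rfl

theorem of_mul_inj {α : Type*} {i j : α} {x y : FreeMonoid α}
    (h : FreeMonoid.of i * x = FreeMonoid.of j * y) : i = j ∧ x = y :=
  List.cons.inj h

theorem eq_one_or_of_mul {α : Type*} (u : FreeMonoid α) : u = 1 ∨ ∃ i x, u = .of i * x := by
  cases u using FreeMonoid.casesOn with
  | one => exact Or.inl rfl
  | of_mul i x => exact Or.inr ⟨i, x, rfl⟩

theorem compatBelow (m N : ℕ) : CompatBelow m N := by
  induction N with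
  | zero => intro _ _ _ _ h; simp at h
  | succ N H =>
    have key : ∀ u v : FreeMonoid (Fin m), conGen (BraidMonoidRel m) u v →
        len (PresentedMonoid.mk (BraidMonoidRel m) u) ≤ N + 1 →
        ∀ (i j : Fin m) (x y : FreeMonoid (Fin m)), u = .of i * x → v = .of j * y →
        Compat i j (.mk _ x) (.mk _ y) := by
      intro u v h
      change ConGen.Rel _ u v at h
      induction h with
      | of u v h =>
        intro _ i j x y hu hv
        cases h with
        | braid a b h =>
          rw [mul_assoc] at hu hv
          obtain ⟨rfl, rfl⟩ := of_mul_inj hu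
          obtain ⟨rfl, rfl⟩ := of_mul_inj hv
          exact (compat_adj h).2 ⟨1, by simp [mk_of], by simp [mk_of]⟩
        | comm a b hab h =>
          obtain ⟨rfl, rfl⟩ := of_mul_inj hu
          obtain ⟨rfl, rfl⟩ := of_mul_inj hv
          exact (compat_far hab h).2 ⟨1, by simp [mk_of], by simp [mk_of]⟩
      | refl u =>
        rintro _ i j x y rfl hv
        obtain ⟨rfl, rfl⟩ := of_mul_inj hv
        exact compat_self.2 rfl
      | symm h ih =>
        intro hl i j x y hu hv
        rw [← PresentedMonoid.mk_eq_mk_iff.2 h] at hl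
        exact (ih hl j i y x hv hu).symm
      | @trans u v w h₁ h₂ ih₁ ih₂ =>
        rintro hl i j x y rfl rfl
        have h₁' := PresentedMonoid.mk_eq_mk_iff.2 h₁
        obtain rfl | ⟨c, z, rfl⟩ := eq_one_or_of_mul v
        · have := congrArg len h₁'
          simp [mk_of] at this
        · have hx := hl
          rw [map_mul, mk_of, len_mul, len_gen] at hx
          exact H.trans (by omega) (ih₁ hl _ _ _ _ rfl rfl)
            (ih₂ (h₁' ▸ hl) _ _ _ _ rfl rfl)
      | @mul w x y z h₁ h₂ ih₁ ih₂ =>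
        intro hl i j X Y hu hv
        have h₁' := PresentedMonoid.mk_eq_mk_iff.2 h₁
        have h₂' := PresentedMonoid.mk_eq_mk_iff.2 h₂
        have hlen := congrArg len h₁'
        rw [map_mul, len_mul] at hl
        obtain rfl | ⟨a, w, rfl⟩ := eq_one_or_of_mul w <;>
          obtain rfl | ⟨b, x, rfl⟩ := eq_one_or_of_mul x
        · rw [one_mul] at hu hv
          exact ih₂ (by omega) i j X Y hu hv
        · simp [mk_of] at hlen
          omega
        · simp [mk_of] at hlen
        · rw [mul_assoc] at hu hv
          obtain ⟨rfl, rfl⟩ := of_mul_inj hu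
          obtain ⟨rfl, rfl⟩ := of_mul_inj hv
          obtain ⟨t, hw, hx⟩ := ih₁ (by omega) _ _ _ _ rfl rfl
          exact ⟨t * .mk _ y, by rw [map_mul, hw, mul_assoc],
            by rw [map_mul, hx, h₂', mul_assoc]⟩
    intro i j x y hx h
    obtain ⟨x, rfl⟩ := PresentedMonoid.surjective_mk x
    obtain ⟨y, rfl⟩ := PresentedMonoid.surjective_mk y
    refine key (.of i * x) (.of j * y) (PresentedMonoid.mk_eq_mk_iff.1 ?_) ?_ i j x y rfl rfl
    · rw [map_mul, map_mul]; exact h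
    · rw [map_mul, len_mul]
      change 1 + _ ≤ _
      omega

theorem compat_of_eq {i j : Fin m} {x y : BraidMonoid m} (h : gen i * x = gen j * y) :
    Compat i j x y :=
  compatBelow m _ i j x y (Nat.lt_succ_self _) h

theorem mul_left_cancel' {u x y : BraidMonoid m} (h : u * x = u * y) : x = y := by
  induction u using induction_gen with
  | one => simpa using h
  | mul i u ih =>
    rw [mul_assoc, mul_assoc] at h
    exact ih (compat_self.1 (compat_of_eq h))

instance : IsLeftCancelMul (BraidMonoid m) := ⟨fun _ _ _ h => mul_left_cancel' h⟩

/-- The Riesz interpolation property for left divisibility of positive braids. -/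
theorem exists_interpolant {u v x y : BraidMonoid m} (hux : u ∣ x) (hvx : v ∣ x) (huy : u ∣ y)
    (hvy : v ∣ y) : ∃ z, u ∣ z ∧ v ∣ z ∧ z ∣ x ∧ z ∣ y := by
  induction hN : len x using Nat.strong_induction_on generalizing u v x y with
  | _ N ih =>
    subst hN
    induction u using induction_gen with
    | one => exact ⟨v, one_dvd v, dvd_rfl, hvx, hvy⟩
    | mul a u _ =>
      induction v using induction_gen with
      | one => exact ⟨_, dvd_rfl, one_dvd _, hux, huy⟩
      | mul b v _ =>
        have key : ∀ {x}, gen a * u ∣ x → gen b * v ∣ x → ∃ x' x'', x = gen a * x' ∧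
            x = gen b * x'' ∧ u ∣ x' ∧ v ∣ x'' ∧ compl a b ∣ x' := by
          rintro x ⟨p, rfl⟩ ⟨q, hq⟩
          rw [mul_assoc, mul_assoc] at hq
          obtain ⟨z, h₁, -⟩ := compat_of_eq hq
          exact ⟨u * p, v * q, mul_assoc _ _ _, by rw [mul_assoc, hq], ⟨p, rfl⟩, ⟨q, rfl⟩, ⟨z, h₁⟩⟩
        obtain ⟨x', x'', hxa, hxb, hux', hvx', hcx⟩ := key hux hvx
        obtain ⟨y', y'', hya, hyb, huy', hvy', hcy⟩ := key huy hvy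
        obtain ⟨w, huw, hcw, hwx, hwy⟩ := ih (len x') (by rw [hxa]; simp) hux' hcx huy' hcy rfl
        obtain ⟨w', hw'⟩ : gen b ∣ gen a * w := by
          refine dvd_trans ?_ (mul_dvd_mul_left _ hcw)
          rw [gen_mul_compl]
          exact dvd_mul_right _ _
        have hdiv : ∀ {x x' x''}, x = gen a * x' → x = gen b * x'' → w ∣ x' → w' ∣ x'' := by
          rintro x x' x'' h₁ h₂ ⟨t, rfl⟩
          refine ⟨t, mul_left_cancel (a := gen b) ?_⟩
          rw [← h₂, h₁, ← mul_assoc, ← mul_assoc, hw']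
        obtain ⟨z, hwz, hvz, hzx, hzy⟩ := ih (len x'') (by rw [hxb]; simp) (hdiv hxa hxb hwx) hvx'
          (hdiv hya hyb hwy) hvy' rfl
        refine ⟨gen b * z, ?_, mul_dvd_mul_left _ hvz, ?_, ?_⟩
        · refine (mul_dvd_mul_left _ huw).trans ?_
          rw [hw']
          exact mul_dvd_mul_left _ hwz
        · rw [hxb]; exact mul_dvd_mul_left _ hzx
        · rw [hyb]; exact mul_dvd_mul_left _ hzy

theorem exists_interpolant_family (s : ℕ → BraidMonoid m) {x y : BraidMonoid m} (k : ℕ)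
    (hx : ∀ i < k, s i ∣ x) (hy : ∀ i < k, s i ∣ y) :
    ∃ z, (∀ i < k, s i ∣ z) ∧ z ∣ x ∧ z ∣ y := by
  induction k with
  | zero => exact ⟨1, by simp, one_dvd _, one_dvd _⟩
  | succ k ih =>
    obtain ⟨z, hz, hzx, hzy⟩ := ih (fun i hi => hx i (by omega)) (fun i hi => hy i (by omega))
    obtain ⟨z', h₁, h₂, h₃, h₄⟩ :=
      exists_interpolant hzx (hx k (by omega)) hzy (hy k (by omega))
    refine ⟨z', fun i hi => ?_, h₃, h₄⟩
    obtain hi | rfl := Nat.lt_succ_iff_lt_or_eq.1 hi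
    · exact (hz i hi).trans h₁
    · exact h₂

/-- The generators of the braid monoid, indexed by all natural numbers. -/
def natGen (m i : ℕ) : BraidMonoid m := if h : i < m then gen ⟨i, h⟩ else 1

theorem natGen_braid {i : ℕ} (hi : i + 1 < m) :
    natGen m i * natGen m (i + 1) * natGen m i =
      natGen m (i + 1) * natGen m i * natGen m (i + 1) := by
  rw [natGen, natGen, dif_pos hi, dif_pos (by omega)]
  exact gen_braid (Or.inl rfl)

theorem natGen_comm {i j : ℕ} (hij : i + 2 ≤ j) :
    natGen m i * natGen m j = natGen m j * natGen m i := by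
  unfold natGen
  split_ifs
  · refine gen_comm ?_
    simp only [BraidAdj]
    omega
  all_goals simp

/-- The product of the first `j` generators. -/
def cox (m : ℕ) : ℕ → BraidMonoid m
  | 0 => 1
  | j + 1 => cox m j * natGen m j

theorem cox_comm {i j : ℕ} (h : j + 1 ≤ i) : cox m j * natGen m i = natGen m i * cox m j := by
  induction j with
  | zero => simp [cox]
  | succ j ih =>
    rw [cox, mul_assoc, natGen_comm (by omega), ← mul_assoc, ih (by omega), mul_assoc]

theorem cox_mul_natGen {i j : ℕ} (h : i + 2 ≤ j) (hj : j ≤ m) :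
    cox m j * natGen m i = natGen m (i + 1) * cox m j := by
  induction j, h using Nat.le_induction with
  | base =>
    calc cox m i * natGen m i * natGen m (i + 1) * natGen m i
        = cox m i * (natGen m i * natGen m (i + 1) * natGen m i) := by simp only [mul_assoc]
      _ = cox m i * natGen m (i + 1) * (natGen m i * natGen m (i + 1)) := by
        rw [natGen_braid (by omega)]; simp only [mul_assoc]
      _ = natGen m (i + 1) * (cox m i * natGen m i * natGen m (i + 1)) := by
        rw [cox_comm le_rfl]; simp only [mul_assoc]
  | succ j hij ih =>
    rw [cox, mul_assoc, ← natGen_comm hij, ← mul_assoc, ih (by omega), mul_assoc]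

theorem exists_cox_succ (j : ℕ) (hj : j + 1 ≤ m) : ∃ d, cox m (j + 1) = natGen m 0 * d ∧
    cox m m * cox m j = d * cox m m := by
  induction j with
  | zero => exact ⟨1, by simp [cox], by simp [cox]⟩
  | succ j ih =>
    obtain ⟨d, h₁, h₂⟩ := ih (by omega)
    refine ⟨d * natGen m (j + 1), by rw [cox, h₁, mul_assoc], ?_⟩
    rw [cox, ← mul_assoc, h₂, mul_assoc, cox_mul_natGen (by omega) le_rfl, mul_assoc]

theorem cox_sq_mul (k : ℕ) :
    cox (k + 1) (k + 1) ^ 2 * natGen (k + 1) k = natGen (k + 1) 0 * cox (k + 1) (k + 1) ^ 2 := by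
  obtain ⟨d, h₁, h₂⟩ := exists_cox_succ (m := k + 1) k le_rfl
  set c := cox (k + 1) (k + 1) with hc
  have h₃ : c = cox (k + 1) k * natGen (k + 1) k := rfl
  calc c ^ 2 * natGen (k + 1) k = natGen (k + 1) 0 * (d * c) * natGen (k + 1) k := by
        rw [sq]; nth_rw 1 [h₁]; simp only [mul_assoc]
    _ = natGen (k + 1) 0 * c * (cox (k + 1) k * natGen (k + 1) k) := by
        rw [← h₂]; simp only [mul_assoc]
    _ = natGen (k + 1) 0 * c ^ 2 := by rw [← h₃, sq, mul_assoc]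

theorem cox_pow_mul_natGen (i l : ℕ) (h : i + l < m) :
    cox m m ^ l * natGen m i = natGen m (i + l) * cox m m ^ l := by
  induction l with
  | zero => simp
  | succ l ih =>
    rw [pow_succ', mul_assoc, ih (by omega), ← mul_assoc, cox_mul_natGen (by omega) le_rfl,
      mul_assoc, add_assoc]

/-- The full twist, a central positive braid divisible by all generators. -/
def fullTwist (m : ℕ) : BraidMonoid m := cox m m ^ (m + 1)

theorem fullTwist_comm_gen (i : Fin m) : Commute (fullTwist m) (gen i) := by
  obtain ⟨i, hi⟩ := i
  obtain ⟨k, rfl⟩ : ∃ k, m = i + k + 1 := ⟨m - i - 1, by omega⟩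
  have hg : gen ⟨i, hi⟩ = natGen (i + k + 1) i := by rw [natGen, dif_pos hi]
  rw [hg, fullTwist, show i + k + 1 + 1 = i + 2 + k by ring, pow_add, pow_add]
  have h₁ := cox_pow_mul_natGen (m := i + k + 1) i k (by omega)
  have h₂ := cox_sq_mul (i + k)
  have h₃ := cox_pow_mul_natGen (m := i + k + 1) 0 i (by omega)
  rw [zero_add] at h₃
  rw [Commute, SemiconjBy, mul_assoc, h₁, ← mul_assoc, mul_assoc (_ ^ i), h₂, ← mul_assoc, h₃]
  simp only [mul_assoc]

theorem fullTwist_comm (x : BraidMonoid m) : Commute (fullTwist m) x := by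
  induction x using induction_gen with
  | one => exact Commute.one_right _
  | mul i x ih => exact (fullTwist_comm_gen i).mul_right ih

theorem gen_dvd_fullTwist (i : Fin m) : gen i ∣ fullTwist m := by
  obtain ⟨i, hi⟩ := i
  obtain ⟨d, hd, -⟩ := exists_cox_succ (m := m) (m - 1) (by omega)
  rw [Nat.sub_add_cancel (by omega)] at hd
  have h := cox_pow_mul_natGen (m := m) 0 i (by omega)
  rw [zero_add] at h
  have hg : gen ⟨i, hi⟩ = natGen m i := by rw [natGen, dif_pos hi]
  have : cox m m ^ (i + 1) = gen ⟨i, hi⟩ * (cox m m ^ i * d) := by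
    rw [hg, ← mul_assoc, ← h, mul_assoc, ← hd, pow_succ]
  exact (Dvd.intro _ this.symm).trans (pow_dvd_pow _ (by omega))

theorem dvd_fullTwist_pow (x : BraidMonoid m) : x ∣ fullTwist m ^ len x := by
  induction x using induction_gen with
  | one => exact one_dvd _
  | mul i x ih =>
    obtain ⟨d, hd⟩ := gen_dvd_fullTwist i
    rw [len_mul, len_gen, add_comm, pow_succ]
    nth_rw 2 [hd]
    rw [← mul_assoc, ((fullTwist_comm _).pow_left _).eq]
    exact (mul_dvd_mul_left _ ih).trans (dvd_mul_right _ _)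

/-- If positive braids `a` and `q` have equal powers and `q` is central, then `a * x = q * x` for
some positive braid `x`. -/
theorem exists_mul_eq_of_pow_eq {a q : BraidMonoid m} (hq : ∀ x, Commute q x) {k : ℕ}
    (hk : k ≠ 0) (h : a ^ k = q ^ k) : ∃ x, a * x = q * x := by
  have hlen : len a = len q := by
    have := congrArg len h
    simp only [len_pow] at this
    exact Nat.eq_of_mul_eq_mul_left (Nat.pos_of_ne_zero hk) this
  let s : ℕ → BraidMonoid m := fun i => q ^ (k - i) * a ^ i
  let U : Set (BraidMonoid m) := {x | ∀ i < k + 1, s i ∣ x}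
  have hU : U.Nonempty := by
    refine ⟨fullTwist m ^ (k * len q), fun i hi => ?_⟩
    convert dvd_fullTwist_pow (s i)
    simp only [s, len_mul, len_pow, hlen, ← add_mul]
    congr 1
    omega
  obtain ⟨x, hxU, hx⟩ := (measure (len : BraidMonoid m → ℕ)).wf.has_min U hU
  have hsucc : ∀ i < k, q * s (i + 1) = a * s i := by
    intro i hi
    simp only [s]
    rw [show k - i = k - (i + 1) + 1 by omega, ← mul_assoc, ← mul_assoc, ← pow_succ', pow_succ' a,
      ← ((hq a).pow_left _).eq, ← mul_assoc]
  have hs : q * s 0 = q * s k := by simp [s, h]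
  obtain ⟨z, hz, hza, hzq⟩ := exists_interpolant_family (fun i => q * s i) (x := a * x)
    (y := q * x) (k + 1) (by
      intro i hi
      have main : ∀ i < k, q * s (i + 1) ∣ a * x := fun i hi => by
        rw [hsucc i hi]
        exact mul_dvd_mul_left _ (hxU i (by omega))
      obtain _ | i := i
      · obtain ⟨k, rfl⟩ := Nat.exists_eq_succ_of_ne_zero hk
        simpa only [hs] using main k (by omega)
      · exact main i (by omega)) (fun i hi => mul_dvd_mul_left _ (hxU i hi))
  obtain ⟨z, rfl⟩ : q ∣ z := (dvd_mul_right _ _).trans (hz 0 (by omega))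
  have hzU : z ∈ U := by
    intro i hi
    obtain ⟨t, ht⟩ := hz i hi
    exact ⟨t, mul_left_cancel (a := q) (by rw [ht, mul_assoc])⟩
  have hle : len x ≤ len z := not_lt.1 (hx z hzU)
  obtain ⟨t, ht⟩ := hza
  obtain ⟨t', ht'⟩ := hzq
  have l := congrArg len ht
  have l' := congrArg len ht'
  simp only [len_mul] at l l'
  have ht1 : t = 1 := eq_one_of_len (by omega)
  have ht1' : t' = 1 := eq_one_of_len (by omega)
  exact ⟨x, by rw [ht, ht', ht1, ht1']⟩

/-- The powers of the full twist. -/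
abbrev twists (m : ℕ) : Submonoid (BraidMonoid m) := Submonoid.powers (fullTwist m)

theorem twists_comm (s : twists m) (x : BraidMonoid m) : Commute (s : BraidMonoid m) x := by
  obtain ⟨_, k, rfl⟩ := s
  exact (fullTwist_comm x).pow_left k

instance : OreLocalization.OreSet (twists m) where
  ore_right_cancel x y s h := ⟨s, by rwa [(twists_comm s x).eq, (twists_comm s y).eq]⟩
  oreNum x _ := x
  oreDenom _ s := s
  ore_eq x s := (twists_comm s x).eq

theorem numeratorHom_injective :
    Function.Injective (OreLocalization.numeratorHom (S := twists m)) := by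
  intro x y h
  simp only [OreLocalization.numeratorHom_apply, OreLocalization.oreDiv_eq_iff] at h
  obtain ⟨u, v, h₁, h₂⟩ := h
  have h₂ : (u : BraidMonoid m) = v := by simpa using h₂
  rw [← h₂] at h₁
  exact (mul_left_cancel h₁).symm

theorem isUnit_numeratorHom_gen (i : Fin m) :
    IsUnit (OreLocalization.numeratorHom (S := twists m) (gen i)) := by
  obtain ⟨d, hd⟩ := gen_dvd_fullTwist i
  have hd' : fullTwist m = d * gen i := by
    refine mul_left_cancel (a := gen i) ?_
    rw [← (fullTwist_comm_gen i).eq, hd, mul_assoc]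
  have hu : IsUnit (OreLocalization.numeratorHom (S := twists m) (fullTwist m)) :=
    OreLocalization.numerator_isUnit ⟨fullTwist m, Submonoid.mem_powers _⟩
  have h₁ := hu
  rw [hd, map_mul] at h₁
  rw [hd', map_mul] at hu
  exact isUnit_iff_exists_and_exists.2
    ⟨⟨_, by rw [← mul_assoc]; exact h₁.mul_val_inv⟩, ⟨_, by rw [mul_assoc]; exact hu.val_inv_mul⟩⟩

end BraidMonoid

namespace BraidGroup

open BraidMonoid

theorem σG_braid {n : ℕ} {i j : Fin (n - 1)} (h : BraidAdj i j) :
    (σG i * σG j * σG i : BraidGroup n) = σG j * σG i * σG j := by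
  have key : ∀ {i j : Fin (n - 1)}, (i : ℕ) + 1 = j →
      (σG i * σG j * σG i : BraidGroup n) = σG j * σG i * σG j := fun h =>
    PresentedGroup.mk_eq_mk_of_mul_inv_mem (Or.inl ⟨_, _, h, rfl⟩)
  obtain h | h := h
  · exact key h
  · exact (key h).symm

theorem σG_comm {n : ℕ} {i j : Fin (n - 1)} (hij : i ≠ j) (h : ¬ BraidAdj i j) :
    (σG i * σG j : BraidGroup n) = σG j * σG i := by
  have key : ∀ {i j : Fin (n - 1)}, (i : ℕ) + 2 ≤ j →
      (σG i * σG j : BraidGroup n) = σG j * σG i := fun h =>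
    PresentedGroup.mk_eq_mk_of_mul_inv_mem (Or.inr ⟨_, _, h, rfl⟩)
  unfold BraidAdj at h
  obtain h' | h' : (i : ℕ) + 2 ≤ j ∨ (j : ℕ) + 2 ≤ i := by omega
  · exact key h'
  · exact (key h').symm

/-- The canonical homomorphism from positive braids to braids. -/
def ofMonoid (n : ℕ) : BraidMonoid (n - 1) →* BraidGroup n :=
  PresentedMonoid.lift σG (by
    rintro _ _ (⟨i, j, h⟩ | ⟨i, j, hij, h⟩)
    · simpa using σG_braid h
    · simpa using σG_comm hij h)

@[simp] theorem ofMonoid_gen {n : ℕ} (i : Fin (n - 1)) : ofMonoid n (gen i) = σG i := rfl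

/-- The canonical homomorphism from braids to the units of the localization of the
monoid of positive braids at the full twist. -/
noncomputable def toLocalization (n : ℕ) :
    BraidGroup n →* (OreLocalization (twists (n - 1)) (BraidMonoid (n - 1)))ˣ :=
  PresentedGroup.toGroup (f := fun i => (isUnit_numeratorHom_gen i).unit) (by
    rintro _ (⟨i, j, h, rfl⟩ | ⟨i, j, h, rfl⟩)
    · simp only [map_mul, map_inv, FreeGroup.lift_apply_of, mul_inv_eq_one]
      ext
      simpa using congrArg (OreLocalization.numeratorHom (S := twists (n - 1)))
        (gen_braid (i := i) (j := j) (Or.inl h))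
    · simp only [map_mul, map_inv, FreeGroup.lift_apply_of, mul_inv_eq_one]
      ext
      simpa using congrArg (OreLocalization.numeratorHom (S := twists (n - 1)))
        (gen_comm (i := i) (j := j) (by unfold BraidAdj; omega)))

theorem toLocalization_ofMonoid {n : ℕ} (x : BraidMonoid (n - 1)) :
    (toLocalization n (ofMonoid n x) : OreLocalization (twists (n - 1)) (BraidMonoid (n - 1))) =
      OreLocalization.numeratorHom x := by
  induction x using induction_gen with
  | one => simpa using (map_one OreLocalization.numeratorHom).symm
  | mul i x ih =>
    have : toLocalization n (σG i) = (isUnit_numeratorHom_gen i).unit :=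
      PresentedGroup.toGroup.of _
    rw [map_mul, map_mul, Units.val_mul, ih, ofMonoid_gen, this, map_mul]
    rfl

theorem ofMonoid_injective (n : ℕ) : Function.Injective (ofMonoid n) := by
  intro x y h
  apply numeratorHom_injective
  rw [← toLocalization_ofMonoid, ← toLocalization_ofMonoid, h]

/-- The canonical homomorphism from the free group to the braid group. -/
def mk (n : ℕ) : FreeGroup (Fin (n - 1)) →* BraidGroup n := PresentedGroup.mk _

theorem mk_surjective (n : ℕ) : Function.Surjective (mk n) := PresentedGroup.mk_surjective _

theorem mk_of {n : ℕ} (i : Fin (n - 1)) : mk n (FreeGroup.of i) = σG i := rfl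

theorem exists_mul_fullTwist_pow {n : ℕ} (g : BraidGroup n) :
    ∃ a p, g * ofMonoid n (fullTwist (n - 1) ^ p) = ofMonoid n a := by
  obtain ⟨w, rfl⟩ := mk_surjective n g
  induction w using FreeGroup.induction_on with
  | C1 => exact ⟨1, 0, by simp⟩
  | of i => exact ⟨gen i, 0, by simp [mk_of]⟩
  | inv_of i _ =>
    obtain ⟨d, hd⟩ := gen_dvd_fullTwist i
    exact ⟨d, 1, by simp [hd, mk_of]⟩
  | mul u v hu hv =>
    obtain ⟨a, p, ha⟩ := hu
    obtain ⟨b, r, hb⟩ := hv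
    refine ⟨a * b, r + p, ?_⟩
    rw [map_mul (ofMonoid n) a, ← ha, mul_assoc, ← map_mul, ((fullTwist_comm b).pow_left p).eq,
      map_mul (ofMonoid n) b, ← hb, pow_add, map_mul, map_mul]
    simp only [mul_assoc]

end BraidGroup

/-- The braid group `B_n` is torsion-free. -/
theorem braidGroup_torsionFree (n : ℕ) (hn : 1 ≤ n) (g : BraidGroup n) (k : ℕ)
    (hk : 1 ≤ k) (h : g ^ k = 1) : g = 1 := by
  obtain ⟨a, p, ha⟩ := BraidGroup.exists_mul_fullTwist_pow g
  set q := BraidMonoid.fullTwist (n - 1) ^ p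
  have hq : ∀ x, Commute q x := fun x => (BraidMonoid.fullTwist_comm x).pow_left p
  have hg : g = BraidGroup.ofMonoid n a * (BraidGroup.ofMonoid n q)⁻¹ := eq_mul_inv_of_mul_eq ha
  have hc : Commute (BraidGroup.ofMonoid n a) (BraidGroup.ofMonoid n q) :=
    ((hq a).map (BraidGroup.ofMonoid n)).symm
  have hpow : a ^ k = q ^ k := by
    apply BraidGroup.ofMonoid_injective n
    rw [hg, hc.inv_right.mul_pow, inv_pow, mul_inv_eq_one] at h
    rw [map_pow, map_pow, h]
  obtain ⟨x, hx⟩ := BraidMonoid.exists_mul_eq_of_pow_eq hq (by omega) hpow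
  have := congrArg (BraidGroup.ofMonoid n) hx
  rw [map_mul, map_mul] at this
  rw [hg, mul_right_cancel this, mul_inv_cancel]
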